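/- Define B(n) = A(n+1), the number of (n+1)-noncrossing trees. Then B(0) = 1 and, for every integer n ≥ 1, B(n) = Σ_{a+b+c = n−1, a,b,c ≥ 0} B(a)·B(b)·B(c). -/

import Mathlib

/-- The noncrossing condition for a graph on the vertex set `ZMod n`
(vertex `j ∈ {1,…,n}` of the paper corresponds to `j - 1 : ZMod n`):
no two edges `{a,b}` and `{c,d}` satisfy `a < c < b < d`. -/
def Noncrossing {n : ℕ} (G : SimpleGraph (ZMod n)) : Prop :=
  ∀ a b c d : ZMod n, G.Adj a b → G.Adj c d →
    ¬(a.val < c.val ∧ c.val < b.val ∧ b.val < d.val)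

/-- An `n`-noncrossing tree: a tree on `n` vertices, drawn on the circle, with no crossing edges. -/
def IsNCTree {n : ℕ} (G : SimpleGraph (ZMod n)) : Prop :=
  G.IsTree ∧ Noncrossing G

/-- `A n` is the number of `n`-noncrossing trees. -/
noncomputable def A (n : ℕ) : ℕ :=
  Nat.card {G : SimpleGraph (ZMod n) // IsNCTree G}

/-- `A₁ n` is the number of `n`-noncrossing trees where vertex `1`
(i.e. `0 : ZMod n`) has degree `1`. -/
noncomputable def A₁ (n : ℕ) : ℕ :=
  Nat.card {G : SimpleGraph (ZMod n) // IsNCTree G ∧ (G.neighborSet 0).ncard = 1}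

/-- `B n = A (n+1)`, the number of `(n+1)`-noncrossing trees. -/
noncomputable def B (n : ℕ) : ℕ := A (n + 1)

namespace SimpleGraph

theorem Reachable.map_of_adj {V W : Type*} {G : SimpleGraph V} {H : SimpleGraph W} (f : V → W)
    (hf : ∀ x y, G.Adj x y → H.Reachable (f x) (f y)) {a b : V} (h : G.Reachable a b) :
    H.Reachable (f a) (f b) := by
  obtain ⟨p⟩ := h
  induction p with
  | nil => exact Reachable.rfl
  | cons hadj _ ih => exact (hf _ _ hadj).trans ih

theorem Reachable.exists_adj_of_mem_of_notMem {V : Type*} {G : SimpleGraph V} {a b : V}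
    (h : G.Reachable a b) (S : Set V) (ha : a ∈ S) (hb : b ∉ S) :
    ∃ x y, G.Adj x y ∧ x ∈ S ∧ y ∉ S ∧ G.Reachable a x ∧ G.Reachable a y := by
  obtain ⟨p⟩ := h
  induction p with
  | nil => exact absurd ha hb
  | @cons u v w hadj _ ih =>
    by_cases hv : v ∈ S
    · obtain ⟨x, y, hxy, hx, hy, hax, hay⟩ := ih hv hb
      exact ⟨x, y, hxy, hx, hy, hadj.reachable.trans hax, hadj.reachable.trans hay⟩
    · exact ⟨u, v, hadj, ha, hv, Reachable.rfl, hadj.reachable⟩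

/-- If `f` collapses every edge of `G` that it does not send identically to an edge of `H`, then
edges of `H` fixed by `f` that are bridges of `H` are also bridges of `G`. -/
theorem IsBridge.of_retraction {V : Type*} {G H : SimpleGraph V} {a b : V}
    (hH : H.IsBridge s(a, b)) (f : V → V) (ha : f a = a) (hb : f b = b)
    (hf : ∀ x y, G.Adj x y → f x = f y ∨ (f x = x ∧ f y = y ∧ H.Adj x y)) :
    G.IsBridge s(a, b) := by
  rw [isBridge_iff] at hH ⊢
  intro h
  have hr := h.map_of_adj (H := H.deleteEdges {s(a, b)}) f fun x y hxy => ?_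
  · rw [ha, hb] at hr
    exact hH hr
  · rw [deleteEdges_adj] at hxy
    rcases hf x y hxy.1 with he | ⟨hx, hy, hadj⟩
    · rw [he]
    · rw [hx, hy]
      exact (deleteEdges_adj.2 ⟨hadj, hxy.2⟩).reachable

end SimpleGraph

open SimpleGraph

/-- `G` is a noncrossing tree on the integer interval `[i, j]`; the integers outside the interval
are isolated vertices of `G`. -/
structure IsNCTreeOn (i j : ℕ) (G : SimpleGraph ℕ) : Prop where
  le_left : ∀ a b, G.Adj a b → i ≤ a
  le_right : ∀ a b, G.Adj a b → a ≤ j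
  reachable : ∀ x, i ≤ x → x ≤ j → G.Reachable i x
  isBridge : ∀ a b, G.Adj a b → G.IsBridge s(a, b)
  noncrossing : ∀ a b c d, G.Adj a b → G.Adj c d → ¬(a < c ∧ c < b ∧ b < d)

/-- The subgraph of edges with both endpoints in `[i, j]`. -/
def SimpleGraph.restrictIcc (G : SimpleGraph ℕ) (i j : ℕ) : SimpleGraph ℕ where
  Adj a b := G.Adj a b ∧ (i ≤ a ∧ a ≤ j) ∧ (i ≤ b ∧ b ≤ j)
  symm := ⟨fun _ _ h => ⟨h.1.symm, h.2.2, h.2.1⟩⟩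
  loopless := ⟨fun _ h => h.1.ne rfl⟩

theorem SimpleGraph.restrictIcc_adj {G : SimpleGraph ℕ} {i j a b : ℕ} :
    (G.restrictIcc i j).Adj a b ↔ G.Adj a b ∧ (i ≤ a ∧ a ≤ j) ∧ (i ≤ b ∧ b ≤ j) := Iff.rfl

theorem SimpleGraph.restrictIcc_le (G : SimpleGraph ℕ) (i j : ℕ) : G.restrictIcc i j ≤ G :=
  fun _ _ h => h.1

/-- The union of three graphs and the edge `{0, m}`. -/
def glue (m : ℕ) (G₁ G₂ G₃ : SimpleGraph ℕ) : SimpleGraph ℕ :=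
  (G₁ ⊔ G₂) ⊔ (G₃ ⊔ edge 0 m)

theorem glue_adj {m : ℕ} {G₁ G₂ G₃ : SimpleGraph ℕ} (hm : 0 < m) {a b : ℕ} :
    (glue m G₁ G₂ G₃).Adj a b ↔
      G₁.Adj a b ∨ G₂.Adj a b ∨ G₃.Adj a b ∨ (a = 0 ∧ b = m) ∨ (a = m ∧ b = 0) := by
  simp only [glue, sup_adj, edge_adj]
  grind

namespace IsNCTreeOn

theorem bounds {i j : ℕ} {G : SimpleGraph ℕ} (h : IsNCTreeOn i j G) {a b : ℕ} (hab : G.Adj a b) :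
    i ≤ a ∧ a ≤ j ∧ i ≤ b ∧ b ≤ j :=
  ⟨h.le_left _ _ hab, h.le_right _ _ hab, h.le_left _ _ hab.symm, h.le_right _ _ hab.symm⟩

theorem restrictIcc {i j i' j' : ℕ} {G : SimpleGraph ℕ} (h : IsNCTreeOn i j G)
    (hr : ∀ x, i' ≤ x → x ≤ j' → (G.restrictIcc i' j').Reachable i' x) :
    IsNCTreeOn i' j' (G.restrictIcc i' j') where
  le_left _ _ hab := hab.2.1.1
  le_right _ _ hab := hab.2.1.2
  reachable := hr
  isBridge a b hab hreach := h.isBridge a b hab.1 <|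
    hreach.mono (deleteEdges_mono (G.restrictIcc_le i' j'))
  noncrossing a b c d hab hcd := h.noncrossing a b c d hab.1 hcd.1

section Glue

variable {k m n : ℕ} {G₁ G₂ G₃ : SimpleGraph ℕ}

theorem isBridge_glue (hkm : k < m) (h₁ : IsNCTreeOn 0 k G₁)
    (h₂ : IsNCTreeOn (k + 1) m G₂) (h₃ : IsNCTreeOn m n G₃) {a b : ℕ}
    (hab : (glue m G₁ G₂ G₃).Adj a b) : (glue m G₁ G₂ G₃).IsBridge s(a, b) := by
  have hm : 0 < m := by lia
  have hcut : (glue m G₁ G₂ G₃).IsBridge s(0, m) := by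
    rw [isBridge_iff]
    intro hr
    obtain ⟨x, y, hxy, hx, hy, -⟩ :=
      hr.exists_adj_of_mem_of_notMem {x | x ≤ k} (Nat.zero_le k) (by simpa using hkm)
    rw [deleteEdges_adj, glue_adj hm] at hxy
    simp only [Set.mem_ofPred_eq, Set.mem_singleton_iff, Sym2.eq_iff] at hx hy hxy
    obtain ⟨h | h | h | h | h, hne⟩ := hxy
    · have := h₁.bounds h; lia
    · have := h₂.bounds h; lia
    · have := h₃.bounds h; lia
    · lia
    · lia
  rcases (glue_adj hm).1 hab with h | h | h | ⟨rfl, rfl⟩ | ⟨rfl, rfl⟩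
  · have hb := h₁.bounds h
    refine (h₁.isBridge a b h).of_retraction (fun x => if x ≤ k then x else 0)
      (by grind) (by grind) fun x y hxy => ?_
    rcases (glue_adj hm).1 hxy with h | h | h | h | h
    · have := h₁.bounds h; grind
    · have := h₂.bounds h; grind
    · have := h₃.bounds h; grind
    · grind
    · grind
  · have hb := h₂.bounds h
    refine (h₂.isBridge a b h).of_retraction (fun x => if k + 1 ≤ x ∧ x ≤ m then x else m)
      (by grind) (by grind) fun x y hxy => ?_
    rcases (glue_adj hm).1 hxy with h | h | h | h | h
    · have := h₁.bounds h; grind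
    · have := h₂.bounds h; grind
    · have := h₃.bounds h; grind
    · grind
    · grind
  · have hb := h₃.bounds h
    refine (h₃.isBridge a b h).of_retraction (fun x => if m ≤ x then x else m)
      (by grind) (by grind) fun x y hxy => ?_
    rcases (glue_adj hm).1 hxy with h | h | h | h | h
    · have := h₁.bounds h; grind
    · have := h₂.bounds h; grind
    · have := h₃.bounds h; grind
    · grind
    · grind
  · exact hcut
  · rw [Sym2.eq_swap]; exact hcut

theorem glue (hkm : k < m) (hmn : m ≤ n) (h₁ : IsNCTreeOn 0 k G₁)
    (h₂ : IsNCTreeOn (k + 1) m G₂) (h₃ : IsNCTreeOn m n G₃) :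
    IsNCTreeOn 0 n (glue m G₁ G₂ G₃) where
  le_left _ _ _ := Nat.zero_le _
  le_right a b hab := by
    rcases (glue_adj (by lia)).1 hab with h | h | h | h | h
    · have := h₁.bounds h; lia
    · have := h₂.bounds h; lia
    · have := h₃.bounds h; lia
    · lia
    · lia
  reachable x _ hx := by
    have hm : 0 < m := by lia
    have l₁ : G₁ ≤ _root_.glue m G₁ G₂ G₃ := fun _ _ h => (glue_adj hm).2 (.inl h)
    have l₂ : G₂ ≤ _root_.glue m G₁ G₂ G₃ := fun _ _ h => (glue_adj hm).2 (.inr (.inl h))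
    have l₃ : G₃ ≤ _root_.glue m G₁ G₂ G₃ := fun _ _ h => (glue_adj hm).2 (.inr (.inr (.inl h)))
    have h0m : (_root_.glue m G₁ G₂ G₃).Reachable 0 m :=
      Adj.reachable ((glue_adj hm).2 (by simp))
    rcases le_or_gt x k with hxk | hxk
    · exact (h₁.reachable x (Nat.zero_le x) hxk).mono l₁
    rcases le_or_gt x m with hxm | hxm
    · exact h0m.trans (((h₂.reachable m hkm le_rfl).symm.trans (h₂.reachable x hxk hxm)).mono l₂)
    · exact h0m.trans ((h₃.reachable x hxm.le hx).mono l₃)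
  isBridge a b hab := isBridge_glue hkm h₁ h₂ h₃ hab
  noncrossing a b c d hab hcd := by
    have hm : 0 < m := by lia
    rcases (glue_adj hm).1 hab with h | h | h | h | h <;>
    rcases (glue_adj hm).1 hcd with h' | h' | h' | h' | h'
    all_goals
      first | have b₁ := h₁.bounds h | have b₁ := h₂.bounds h | have b₁ := h₃.bounds h | skip
      first | have b₂ := h₁.bounds h' | have b₂ := h₂.bounds h' | have b₂ := h₃.bounds h' | skip
      first
        | lia
        | exact h₁.noncrossing _ _ _ _ h h'
        | exact h₂.noncrossing _ _ _ _ h h'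
        | exact h₃.noncrossing _ _ _ _ h h'

theorem restrictIcc_glue_left (hkm : k < m) (h₁ : IsNCTreeOn 0 k G₁)
    (h₂ : IsNCTreeOn (k + 1) m G₂) (h₃ : IsNCTreeOn m n G₃) :
    (_root_.glue m G₁ G₂ G₃).restrictIcc 0 k = G₁ := by
  ext a b
  rw [restrictIcc_adj, glue_adj (by lia)]
  have b₁ := h₁.bounds (a := a) (b := b)
  have b₂ := h₂.bounds (a := a) (b := b)
  have b₃ := h₃.bounds (a := a) (b := b)
  grind

theorem restrictIcc_glue_middle (hkm : k < m) (h₁ : IsNCTreeOn 0 k G₁)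
    (h₂ : IsNCTreeOn (k + 1) m G₂) (h₃ : IsNCTreeOn m n G₃) :
    (_root_.glue m G₁ G₂ G₃).restrictIcc (k + 1) m = G₂ := by
  ext a b
  rw [restrictIcc_adj, glue_adj (by lia)]
  have b₁ := h₁.bounds (a := a) (b := b)
  have b₂ := h₂.bounds (a := a) (b := b)
  have b₃ := h₃.bounds (a := a) (b := b)
  have := G₃.ne_of_adj (a := a) (b := b)
  grind

theorem restrictIcc_glue_right (hkm : k < m) (h₁ : IsNCTreeOn 0 k G₁)
    (h₂ : IsNCTreeOn (k + 1) m G₂) (h₃ : IsNCTreeOn m n G₃) :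
    (_root_.glue m G₁ G₂ G₃).restrictIcc m n = G₃ := by
  ext a b
  rw [restrictIcc_adj, glue_adj (by lia)]
  have b₁ := h₁.bounds (a := a) (b := b)
  have b₂ := h₂.bounds (a := a) (b := b)
  have b₃ := h₃.bounds (a := a) (b := b)
  have := G₂.ne_of_adj (a := a) (b := b)
  grind

variable {k' m' : ℕ} {G₁' G₂' G₃' : SimpleGraph ℕ}

theorem le_of_glue_eq_glue (hkm : k < m) (h₁ : IsNCTreeOn 0 k G₁)
    (h₂ : IsNCTreeOn (k + 1) m G₂) (h₃ : IsNCTreeOn m n G₃) (hm' : 0 < m')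
    (heq : _root_.glue m G₁ G₂ G₃ = _root_.glue m' G₁' G₂' G₃') : m' ≤ m := by
  have h : (_root_.glue m G₁ G₂ G₃).Adj 0 m' := by
    rw [heq, glue_adj (by lia)]; simp
  rcases (glue_adj (by lia)).1 h with h | h | h | h | h
  · have := h₁.bounds h; lia
  · have := h₂.bounds h; lia
  · have := h₃.bounds h; lia
  · lia
  · lia

theorem le_of_glue_eq_glue_of_eq (hkm : k < m) (h₁ : IsNCTreeOn 0 k G₁)
    (h₂ : IsNCTreeOn (k + 1) m G₂) (h₃ : IsNCTreeOn m n G₃) (hkm' : k' < m)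
    (h₁' : IsNCTreeOn 0 k' G₁')
    (heq : _root_.glue m G₁ G₂ G₃ = _root_.glue m G₁' G₂' G₃') : k' ≤ k := by
  by_contra! hlt
  obtain ⟨x, y, hxy, hx, hy, -⟩ := (h₁'.reachable (k + 1) (Nat.zero_le _)
    hlt).exists_adj_of_mem_of_notMem {x | x ≤ k} (Nat.zero_le k) (by simp)
  simp only [Set.mem_ofPred_eq] at hx hy
  have hb := h₁'.bounds hxy
  have h : (_root_.glue m G₁ G₂ G₃).Adj x y := by
    rw [heq, glue_adj (by lia)]; exact .inl hxy
  rcases (glue_adj (by lia)).1 h with h | h | h | h | h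
  · have := h₁.bounds h; lia
  · have := h₂.bounds h; lia
  · have := h₃.bounds h; lia
  · lia
  · lia

end Glue

/-- Every noncrossing tree on `[0, n]` with `n ≥ 1` splits at the largest neighbor `m` of `0`. -/
theorem exists_eq_glue {n : ℕ} (hn : 1 ≤ n) {G : SimpleGraph ℕ} (h : IsNCTreeOn 0 n G) :
    ∃ k m, k < m ∧ m ≤ n ∧ IsNCTreeOn 0 k (G.restrictIcc 0 k) ∧
      IsNCTreeOn (k + 1) m (G.restrictIcc (k + 1) m) ∧ IsNCTreeOn m n (G.restrictIcc m n) ∧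
      _root_.glue m (G.restrictIcc 0 k) (G.restrictIcc (k + 1) m) (G.restrictIcc m n) = G := by
  classical
  obtain ⟨m, h0m, hmax⟩ : ∃ m, G.Adj 0 m ∧ ∀ x, G.Adj 0 x → x ≤ m := by
    obtain ⟨x, y, hxy, hx, -⟩ := (h.reachable 1 (Nat.zero_le 1) hn).exists_adj_of_mem_of_notMem
      {0} (by simp) (by simp)
    obtain rfl : x = 0 := hx
    have hle : ∀ x, G.Adj 0 x → x ≤ n := fun x hx => (h.bounds hx).2.2.2
    exact ⟨Nat.findGreatest (G.Adj 0) n, Nat.findGreatest_spec (hle y hxy) hxy,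
      fun x hx => Nat.le_findGreatest (hle x hx) hx⟩
  have hmn : m ≤ n := (h.bounds h0m).2.2.2
  have hm : 0 < m := Nat.pos_of_ne_zero h0m.ne'
  set H := G.deleteEdges {s(0, m)} with hH
  have hHadj : ∀ a b, H.Adj a b ↔ G.Adj a b ∧ ¬(a = 0 ∧ b = m) ∧ ¬(a = m ∧ b = 0) := by
    intro a b
    simp only [hH, deleteEdges_adj, Set.mem_singleton_iff, Sym2.eq_iff]
    grind
  have hnot : ¬H.Reachable 0 m := h.isBridge 0 m h0m
  have hcases : ∀ x, x ≤ n → H.Reachable 0 x ∨ H.Reachable m x := by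
    intro x hx
    by_contra hcon
    obtain ⟨a, b, hab, ha, hb, -⟩ := (h.reachable x (Nat.zero_le x) hx).exists_adj_of_mem_of_notMem
      {y | H.Reachable 0 y ∨ H.Reachable m y} (.inl .rfl) hcon
    refine hb ?_
    by_cases hcut : (a = 0 ∧ b = m) ∨ (a = m ∧ b = 0)
    · rcases hcut with ⟨rfl, rfl⟩ | ⟨rfl, rfl⟩
      · exact .inr .rfl
      · exact .inl .rfl
    · have hr : H.Reachable a b := ((hHadj a b).2 ⟨hab, by tauto⟩).reachable
      exact ha.imp (·.trans hr) (·.trans hr)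
  have hover : ∀ a b, G.Adj a b → a < m → b ≤ m := by
    intro a b hab ham
    by_contra! hb
    rcases Nat.eq_zero_or_pos a with rfl | ha
    · exact absurd (hmax b hab) (by lia)
    · exact h.noncrossing 0 m a b h0m hab (by lia)
  have hlt : ∀ y, H.Reachable 0 y → y < m := by
    intro y hy
    by_contra! hym
    obtain ⟨a, b, hab, ha, hb, -, h0b⟩ := hy.exists_adj_of_mem_of_notMem {x | x < m} hm
      (by simpa using hym)
    simp only [Set.mem_ofPred_eq] at ha hb
    have := hover a b ((hHadj a b).1 hab).1 ha
    obtain rfl : b = m := by lia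
    exact hnot h0b
  have hdown : ∀ x y, x ≤ y → H.Reachable 0 y → H.Reachable 0 x := by
    intro x y hxy hy
    by_contra hx
    have hym := hlt y hy
    have hmx : H.Reachable m x := (hcases x (by lia)).resolve_left hx
    have hx0 : x ≠ 0 := by rintro rfl; exact hx .rfl
    have hxy' : x ≠ y := by rintro rfl; exact hx hy
    obtain ⟨u, v, huv, hu, hv, h0u, h0v⟩ := hy.exists_adj_of_mem_of_notMem {z | z < x}
      (Nat.pos_of_ne_zero hx0) (by simpa using hxy)
    simp only [Set.mem_ofPred_eq] at hu hv
    have hvm := hlt v h0v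
    have hxv : x ≠ v := by rintro rfl; exact hx h0v
    obtain ⟨p, q, hpq, hp, hq, hxp, hxq⟩ := hmx.symm.exists_adj_of_mem_of_notMem
      {z | u < z ∧ z < v} ⟨hu, by lia⟩ (by simp only [Set.mem_ofPred_eq]; lia)
    simp only [Set.mem_ofPred_eq] at hp hq
    have hqu : q ≠ u := by rintro rfl; exact hx (h0u.trans hxq.symm)
    have hqv : q ≠ v := by rintro rfl; exact hx (h0v.trans hxq.symm)
    have huv' := ((hHadj u v).1 huv).1
    have hpq' := ((hHadj p q).1 hpq).1
    rcases lt_or_ge q u with hqu' | hqu'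
    · exact h.noncrossing q p u v hpq'.symm huv' (by lia)
    · exact h.noncrossing u v p q huv' hpq' (by lia)
  obtain ⟨k, hk, hkmax⟩ : ∃ k, H.Reachable 0 k ∧ ∀ x, H.Reachable 0 x → x ≤ k :=
    ⟨Nat.findGreatest (H.Reachable 0) m, Nat.findGreatest_spec (m := 0) (Nat.zero_le m) .rfl,
      fun x hx => Nat.le_findGreatest (hlt x hx).le hx⟩
  have hkm := hlt k hk
  have hiff : ∀ x, H.Reachable 0 x ↔ x ≤ k := fun x => ⟨hkmax x, fun hx => hdown x k hx hk⟩
  have hedge : ∀ a b, H.Adj a b → (a ≤ k ∧ b ≤ k) ∨ ((k + 1 ≤ a ∧ a ≤ m) ∧ (k + 1 ≤ b ∧ b ≤ m)) ∨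
      ((m ≤ a ∧ a ≤ n) ∧ (m ≤ b ∧ b ≤ n)) := by
    intro a b hab
    have hG := ((hHadj a b).1 hab).1
    have h₁ : a ≤ k ↔ b ≤ k := by
      rw [← hiff, ← hiff]
      exact ⟨(·.trans hab.reachable), (·.trans hab.symm.reachable)⟩
    have h₂ := hover a b hG
    have h₃ := hover b a hG.symm
    have h₄ := h.bounds hG
    lia
  refine ⟨k, m, hkm, hmn, h.restrictIcc fun x _ hx => ?_, h.restrictIcc fun x hx hx' => ?_,
    h.restrictIcc fun x hx hx' => ?_, ?_⟩
  · have := ((hiff x).2 hx).map_of_adj (H := G.restrictIcc 0 k) (fun x => min x k) ?_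
    · simpa [hx] using this
    intro a b hab
    rcases hedge a b hab with hb | hb | hb
    · exact Adj.reachable (by
        rw [min_eq_left hb.1, min_eq_left hb.2]
        exact ⟨((hHadj a b).1 hab).1, by lia⟩)
    · rw [min_eq_right (by lia), min_eq_right (by lia)]
    · rw [min_eq_right (by lia), min_eq_right (by lia)]
  · have key : ∀ y, k + 1 ≤ y → y ≤ m → (G.restrictIcc (k + 1) m).Reachable m y := by
      intro y hy hy'
      have hr := (hcases y (by lia)).resolve_left (by rw [hiff]; lia)
      have := hr.map_of_adj (H := G.restrictIcc (k + 1) m) (fun x => min (max x (k + 1)) m) ?_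
      · rwa [max_eq_left (by lia), max_eq_left (by lia), min_self, min_eq_left hy'] at this
      intro a b hab
      rcases hedge a b hab with hb | hb | hb
      · rw [max_eq_right (by lia), max_eq_right (by lia)]
      · exact Adj.reachable (by
          rw [max_eq_left (by lia), max_eq_left (by lia), min_eq_left (by lia),
            min_eq_left (by lia)]
          exact ⟨((hHadj a b).1 hab).1, hb⟩)
      · rw [max_eq_left (by lia), max_eq_left (by lia), min_eq_right (by lia),
            min_eq_right (by lia)]
    exact (key (k + 1) le_rfl hkm).symm.trans (key x hx hx')
  · have hr := (hcases x hx').resolve_left (by rw [hiff]; lia)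
    have := hr.map_of_adj (H := G.restrictIcc m n) (fun x => max x m) ?_
    · rwa [max_self, max_eq_left hx] at this
    intro a b hab
    rcases hedge a b hab with hb | hb | hb
    · rw [max_eq_right (by lia), max_eq_right (by lia)]
    · rw [max_eq_right (by lia), max_eq_right (by lia)]
    · exact Adj.reachable (by
        rw [max_eq_left (by lia), max_eq_left (by lia)]
        exact ⟨((hHadj a b).1 hab).1, hb⟩)
  · ext a b
    rw [glue_adj hm, restrictIcc_adj, restrictIcc_adj, restrictIcc_adj]
    have h₁ := hedge a b
    rw [hHadj] at h₁
    have h₂ := h0m.symm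
    grind

end IsNCTreeOn

/-- The order embedding of `ZMod (n + 1)` onto the interval `[i, i + n]`. -/
def ZMod.shiftVal (i n : ℕ) : ZMod (n + 1) ↪ ℕ where
  toFun x := i + x.val
  inj' _ _ h := ZMod.val_injective _ (Nat.add_left_cancel h)

theorem ZMod.shiftVal_apply (i n : ℕ) (x : ZMod (n + 1)) : ZMod.shiftVal i n x = i + x.val := rfl

theorem ZMod.shiftVal_natCast_sub {i n x : ℕ} (hi : i ≤ x) (hx : x ≤ i + n) :
    ZMod.shiftVal i n ((x - i : ℕ) : ZMod (n + 1)) = x := by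
  rw [shiftVal_apply, ZMod.val_natCast_of_lt (by lia)]
  lia

theorem ZMod.natCast_shiftVal_sub (i n : ℕ) (u : ZMod (n + 1)) :
    ((ZMod.shiftVal i n u - i : ℕ) : ZMod (n + 1)) = u := by
  rw [shiftVal_apply, Nat.add_sub_cancel_left, ZMod.natCast_zmod_val]

theorem isNCTreeOn_map_shiftVal_iff (i n : ℕ) (G : SimpleGraph (ZMod (n + 1))) :
    IsNCTreeOn i (i + n) (G.map (ZMod.shiftVal i n)) ↔ IsNCTree G := by
  set e := ZMod.shiftVal i n with he
  have hfe : ∀ u, ((e u - i : ℕ) : ZMod (n + 1)) = u := ZMod.natCast_shiftVal_sub i n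
  have hlt : ∀ u : ZMod (n + 1), u.val < n + 1 := fun u => ZMod.val_lt u
  constructor
  · intro h
    refine ⟨⟨?_, ?_⟩, ?_⟩
    · have h0 : ∀ u, G.Reachable 0 u := by
        intro u
        have := (h.reachable (e u) (by simp [he, ZMod.shiftVal_apply])
          (by have := hlt u; rw [he, ZMod.shiftVal_apply]; lia)).map_of_adj (H := G)
            (fun x => ((x - i : ℕ) : ZMod (n + 1))) ?_
        · simpa [hfe] using this
        intro x y hxy
        obtain ⟨u, v, huv, rfl, rfl⟩ := (map_adj _ _ _ _).1 hxy
        simpa only [hfe] using huv.reachable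
      exact ⟨fun u v => (h0 u).symm.trans (h0 v)⟩
    · rw [isAcyclic_iff_forall_adj_isBridge]
      intro u v huv
      rw [isBridge_iff]
      intro hr
      refine h.isBridge (e u) (e v) (map_adj_apply.2 huv) (hr.map_of_adj e fun x y hxy => ?_)
      refine Adj.reachable ?_
      rw [deleteEdges_adj] at hxy ⊢
      refine ⟨map_adj_apply.2 hxy.1, ?_⟩
      simpa [Sym2.eq_iff] using hxy.2
    · intro a b c d hab hcd hlt
      refine h.noncrossing (e a) (e b) (e c) (e d) (map_adj_apply.2 hab) (map_adj_apply.2 hcd) ?_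
      simp only [he, ZMod.shiftVal_apply]
      lia
  · rintro ⟨⟨hc, ha⟩, hnc⟩
    rw [isAcyclic_iff_forall_adj_isBridge] at ha
    refine ⟨fun a b hab => ?_, fun a b hab => ?_, fun x hx hx' => ?_, fun a b hab hr => ?_,
      fun a b c d hab hcd => ?_⟩
    · obtain ⟨u, v, huv, rfl, rfl⟩ := (map_adj _ _ _ _).1 hab
      simp [he, ZMod.shiftVal_apply]
    · obtain ⟨u, v, huv, rfl, rfl⟩ := (map_adj _ _ _ _).1 hab
      have := hlt u
      rw [he, ZMod.shiftVal_apply]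
      lia
    · have := (hc.preconnected 0 ((x - i : ℕ) : ZMod (n + 1))).map_of_adj (H := G.map e) e
        fun a b hab => (map_adj_apply.2 hab).reachable
      rw [ZMod.shiftVal_natCast_sub hx hx'] at this
      simpa [he, ZMod.shiftVal_apply] using this
    · obtain ⟨u, v, huv, rfl, rfl⟩ := (map_adj _ _ _ _).1 hab
      refine ha huv ?_
      have := hr.map_of_adj (H := G.deleteEdges {s(u, v)})
        (fun x => ((x - i : ℕ) : ZMod (n + 1))) ?_
      · simpa only [hfe] using this
      intro x y hxy
      rw [deleteEdges_adj] at hxy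
      obtain ⟨hxy, hne⟩ := hxy
      obtain ⟨u', v', huv', rfl, rfl⟩ := (map_adj _ _ _ _).1 hxy
      simp only [hfe]
      refine Adj.reachable ?_
      rw [deleteEdges_adj]
      refine ⟨huv', ?_⟩
      simpa [Sym2.eq_iff] using hne
    · obtain ⟨u, v, huv, rfl, rfl⟩ := (map_adj _ _ _ _).1 hab
      obtain ⟨u', v', huv', rfl, rfl⟩ := (map_adj _ _ _ _).1 hcd
      have := hnc u v u' v' huv huv'
      simp only [he, ZMod.shiftVal_apply]
      lia

/-- Noncrossing trees on `ZMod (n + 1)` correspond to noncrossing trees on `[i, i + n]`. -/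
noncomputable def ncTreeEquiv (i n : ℕ) :
    {G : SimpleGraph (ZMod (n + 1)) // IsNCTree G} ≃ {G // IsNCTreeOn i (i + n) G} :=
  Equiv.ofBijective
    (fun G => ⟨G.1.map (ZMod.shiftVal i n), (isNCTreeOn_map_shiftVal_iff i n G.1).2 G.2⟩) <| by
    constructor
    · intro G G' h
      exact Subtype.ext (map_injective _ (congrArg Subtype.val h))
    · rintro ⟨G, hG⟩
      have hmap : (G.comap (ZMod.shiftVal i n)).map (ZMod.shiftVal i n) = G := by
        ext a b
        rw [map_adj]
        constructor
        · rintro ⟨u, v, huv, rfl, rfl⟩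
          exact huv
        · intro hab
          obtain ⟨h₁, h₂, h₃, h₄⟩ := hG.bounds hab
          refine ⟨((a - i : ℕ) : ZMod (n + 1)), ((b - i : ℕ) : ZMod (n + 1)), ?_,
            ZMod.shiftVal_natCast_sub h₁ h₂, ZMod.shiftVal_natCast_sub h₃ h₄⟩
          rwa [comap_adj, ZMod.shiftVal_natCast_sub h₁ h₂, ZMod.shiftVal_natCast_sub h₃ h₄]
      refine ⟨⟨G.comap (ZMod.shiftVal i n), ?_⟩, Subtype.ext hmap⟩
      rw [← isNCTreeOn_map_shiftVal_iff i n, hmap]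
      exact hG

theorem finite_isNCTreeOn {i j : ℕ} (hij : i ≤ j) : Finite {G // IsNCTreeOn i j G} := by
  obtain ⟨n, rfl⟩ := Nat.exists_eq_add_of_le hij
  exact Finite.of_equiv _ (ncTreeEquiv i n)

theorem card_isNCTreeOn {i j n : ℕ} (hij : i + n = j) :
    Nat.card {G // IsNCTreeOn i j G} = B n := by
  subst hij
  exact (Nat.card_congr (ncTreeEquiv i n)).symm

theorem B_zero : B 0 = 1 := by
  rw [← card_isNCTreeOn (i := 0) (j := 0) rfl, Nat.card_eq_one_iff_unique]
  refine ⟨⟨fun G G' => Subtype.ext ?_⟩, ⟨⊥, ?_⟩⟩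
  · have h : ∀ G : SimpleGraph ℕ, IsNCTreeOn 0 0 G → G = ⊥ := by
      intro G h
      ext a b
      simp only [bot_adj, iff_false]
      intro hab
      have := h.bounds hab
      exact hab.ne (by lia)
    rw [h _ G.2, h _ G'.2]
  · refine ⟨by simp, by simp, fun x _ hx => ?_, by simp, by simp⟩
    obtain rfl : x = 0 := by lia
    exact Reachable.rfl

/-- The triples of noncrossing trees on `[0, a]`, `[a + 1, a + b + 1]` and `[a + b + 1, n]` with
`(a, b) = (f 0, f 1)`. -/
abbrev NCTreeTriple (n : ℕ) (f : Fin 3 → ℕ) : Type :=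
  {G // IsNCTreeOn 0 (f 0) G} × {G // IsNCTreeOn (f 0 + 1) (f 0 + f 1 + 1) G} ×
    {G // IsNCTreeOn (f 0 + f 1 + 1) n G}

theorem sum_eq_of_mem_antidiagonalTuple {n : ℕ} (hn : 1 ≤ n) {f : Fin 3 → ℕ}
    (hf : f ∈ Finset.Nat.antidiagonalTuple 3 (n - 1)) : f 0 + f 1 + 1 + f 2 = n := by
  rw [Finset.Nat.mem_antidiagonalTuple, Fin.sum_univ_three] at hf
  lia

/-- Gluing a triple of noncrossing trees along the edge `{0, f 0 + f 1 + 1}`. -/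
def glueTriple {n : ℕ} (hn : 1 ≤ n)
    (t : Σ f : {f // f ∈ Finset.Nat.antidiagonalTuple 3 (n - 1)}, NCTreeTriple n f.1) :
    {G // IsNCTreeOn 0 n G} :=
  ⟨glue (t.1.1 0 + t.1.1 1 + 1) t.2.1.1 t.2.2.1.1 t.2.2.2.1,
    .glue (by lia) (by have := sum_eq_of_mem_antidiagonalTuple hn t.1.2; lia)
      t.2.1.2 t.2.2.1.2 t.2.2.2.2⟩

theorem glueTriple_bijective {n : ℕ} (hn : 1 ≤ n) : Function.Bijective (glueTriple hn) := by
  constructor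
  · rintro ⟨⟨f, hf⟩, ⟨G₁, h₁⟩, ⟨G₂, h₂⟩, ⟨G₃, h₃⟩⟩ ⟨⟨f', hf'⟩, ⟨G₁', h₁'⟩, ⟨G₂', h₂'⟩, ⟨G₃', h₃'⟩⟩ h
    replace h := congrArg Subtype.val h
    simp only [glueTriple] at h h₁ h₂ h₃ h₁' h₂' h₃'
    have hs := sum_eq_of_mem_antidiagonalTuple hn hf
    have hs' := sum_eq_of_mem_antidiagonalTuple hn hf'
    have hm : f 0 + f 1 + 1 = f' 0 + f' 1 + 1 := le_antisymm
      (IsNCTreeOn.le_of_glue_eq_glue (by lia) h₁' h₂' h₃' (Nat.succ_pos _) h.symm)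
      (IsNCTreeOn.le_of_glue_eq_glue (by lia) h₁ h₂ h₃ (Nat.succ_pos _) h)
    have hk : f 0 = f' 0 := by
      refine le_antisymm ?_ ?_
      · rw [hm] at h
        exact IsNCTreeOn.le_of_glue_eq_glue_of_eq (by lia) h₁' h₂' h₃' (by lia) h₁ h.symm
      · rw [← hm] at h
        exact IsNCTreeOn.le_of_glue_eq_glue_of_eq (by lia) h₁ h₂ h₃ (by lia) h₁' h
    obtain rfl : f = f' := by
      ext x
      fin_cases x
      · exact hk
      · simp; lia
      · simp; lia
    have e₁ := IsNCTreeOn.restrictIcc_glue_left (by lia) h₁ h₂ h₃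
    have e₂ := IsNCTreeOn.restrictIcc_glue_middle (by lia) h₁ h₂ h₃
    have e₃ := IsNCTreeOn.restrictIcc_glue_right (by lia) h₁ h₂ h₃
    rw [h] at e₁ e₂ e₃
    rw [IsNCTreeOn.restrictIcc_glue_left (by lia) h₁' h₂' h₃'] at e₁
    rw [IsNCTreeOn.restrictIcc_glue_middle (by lia) h₁' h₂' h₃'] at e₂
    rw [IsNCTreeOn.restrictIcc_glue_right (by lia) h₁' h₂' h₃'] at e₃
    subst e₁ e₂ e₃
    rfl
  · rintro ⟨G, hG⟩
    obtain ⟨k, m, hkm, hmn, h₁, h₂, h₃, heq⟩ := hG.exists_eq_glue hn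
    obtain ⟨b, rfl⟩ : ∃ b, m = k + b + 1 := ⟨m - k - 1, by lia⟩
    refine ⟨⟨⟨![k, b, n - (k + b + 1)], ?_⟩, ⟨_, h₁⟩, ⟨_, h₂⟩, ⟨_, h₃⟩⟩, Subtype.ext heq⟩
    rw [Finset.Nat.mem_antidiagonalTuple, Fin.sum_univ_three]
    simp
    lia

theorem B_ternary_convolution :
    B 0 = 1 ∧
    ∀ n : ℕ, 1 ≤ n →
      B n = ∑ f ∈ Finset.Nat.antidiagonalTuple 3 (n - 1), B (f 0) * B (f 1) * B (f 2) := by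
  refine ⟨B_zero, fun n hn => ?_⟩
  have hfin : ∀ f : {f // f ∈ Finset.Nat.antidiagonalTuple 3 (n - 1)},
      Finite (NCTreeTriple n f.1) := by
    intro f
    have := sum_eq_of_mem_antidiagonalTuple hn f.2
    have := finite_isNCTreeOn (Nat.zero_le (f.1 0))
    have := finite_isNCTreeOn (i := f.1 0 + 1) (j := f.1 0 + f.1 1 + 1) (by lia)
    have := finite_isNCTreeOn (i := f.1 0 + f.1 1 + 1) (j := n) (by lia)
    infer_instance
  rw [← card_isNCTreeOn (i := 0) (Nat.zero_add n),
    ← Nat.card_eq_of_bijective _ (glueTriple_bijective hn), Nat.card_sigma,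
    ← Finset.sum_coe_sort (Finset.Nat.antidiagonalTuple 3 (n - 1))]
  refine Finset.sum_congr rfl fun f _ => ?_
  rw [Nat.card_prod, Nat.card_prod, card_isNCTreeOn (Nat.zero_add (f.1 0)),
    card_isNCTreeOn (n := f.1 1) (by lia),
    card_isNCTreeOn (n := f.1 2) (sum_eq_of_mem_antidiagonalTuple hn f.2), mul_assoc]
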